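/- Let U ⊆ ℝ² be a contractible open set and let c, d : U → ℝ be smooth functions. Then the pair of equations X³d + (XY + Z)c = 0 and Y²c + (YX² − ZX + W)d = 0 holds on U if and only if there exist smooth functions a, b : U → ℝ and a constant E ∈ ℝ such that X³b − (X²Y + XZ + W)a = c and Y²a − (YX − Z)b = E + d on U. -/

import Mathlib

/-- Second Grushin operator `X = ∂/∂x` on `ℝ²` with coordinates `(x, y)`. -/
noncomputable def opX (f : (Fin 2 → ℝ) → ℝ) : (Fin 2 → ℝ) → ℝ :=
  fun p => fderiv ℝ f p ![1, 0]

/-- Second Grushin operator `Y = x² ∂/∂y` on `ℝ²`. -/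
noncomputable def opY (f : (Fin 2 → ℝ) → ℝ) : (Fin 2 → ℝ) → ℝ :=
  fun p => fderiv ℝ f p ![0, (p 0) ^ 2]

/-- Second Grushin operator `Z = [X, Y] = 2x ∂/∂y` on `ℝ²`. -/
noncomputable def opZ (f : (Fin 2 → ℝ) → ℝ) : (Fin 2 → ℝ) → ℝ :=
  fun p => fderiv ℝ f p ![0, 2 * p 0]

/-- Second Grushin operator `W = [X, Z] = 2 ∂/∂y` on `ℝ²`. -/
noncomputable def opW (f : (Fin 2 → ℝ) → ℝ) : (Fin 2 → ℝ) → ℝ :=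
  fun p => fderiv ℝ f p ![0, 2]

section
open Set Filter Topology MeasureTheory

theorem hasFDerivAt_intervalIntegral_of_contDiff {E F : Type*} [NormedAddCommGroup E]
    [NormedSpace ℝ E] [FiniteDimensional ℝ E] [NormedAddCommGroup F] [NormedSpace ℝ F]
    [CompleteSpace F] {G : E × ℝ → F} (hG : ContDiff ℝ 1 G) (p : E) :
    HasFDerivAt (fun p => ∫ t in (0 : ℝ)..1, G (p, t))
      (∫ t in (0 : ℝ)..1, (fderiv ℝ G (p, t)).comp (ContinuousLinearMap.inl ℝ E ℝ)) p := by
  have hcont : Continuous fun q : E × ℝ =>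
      (fderiv ℝ G q).comp (ContinuousLinearMap.inl ℝ E ℝ) :=
    (hG.continuous_fderiv one_ne_zero).clm_comp continuous_const
  obtain ⟨C, hC⟩ := ((isCompact_closedBall p 1).prod (isCompact_Icc (a := (0 : ℝ)) (b := 1)))
    |>.exists_bound_of_continuousOn hcont.continuousOn
  refine intervalIntegral.hasFDerivAt_integral_of_dominated_of_fderiv_le
    (F' := fun p t => (fderiv ℝ G (p, t)).comp (ContinuousLinearMap.inl ℝ E ℝ))
    (bound := fun _ => C) (Metric.closedBall_mem_nhds p one_pos) (.of_forall fun q => ?_)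
    ?_ ?_ (.of_forall fun t ht q hq => ?_) (by simp) (.of_forall fun t _ q _ => ?_)
  · exact (hG.continuous.comp (by fun_prop : Continuous fun t : ℝ => (q, t))).aestronglyMeasurable
  · exact (hG.continuous.comp
      (by fun_prop : Continuous fun t : ℝ => (p, t))).intervalIntegrable _ _
  · exact (hcont.comp (by fun_prop : Continuous fun t : ℝ => (p, t))).aestronglyMeasurable
  · rw [uIoc_of_le zero_le_one] at ht
    exact hC (q, t) ⟨hq, Ioc_subset_Icc_self ht⟩
  · exact ((hG.differentiable one_ne_zero) (q, t)).hasFDerivAt.comp q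
      (hasFDerivAt_prodMk_left q t)

theorem contDiff_intervalIntegral_nat {E : Type} [NormedAddCommGroup E]
    [NormedSpace ℝ E] [FiniteDimensional ℝ E] (n : ℕ) :
    ∀ {F : Type} [NormedAddCommGroup F] [NormedSpace ℝ F] [CompleteSpace F] {G : E × ℝ → F},
      ContDiff ℝ (⊤ : ℕ∞) G → ContDiff ℝ n fun p => ∫ t in (0 : ℝ)..1, G (p, t) := by
  induction n with
  | zero =>
    intro F _ _ _ G hG
    refine contDiff_zero.2 ?_
    exact intervalIntegral.continuous_parametric_intervalIntegral_of_continuous'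
      (f := fun p t => G (p, t)) hG.continuous 0 1
  | succ n ih =>
    intro F _ _ _ G hG
    have h := hasFDerivAt_intervalIntegral_of_contDiff (hG.of_le (by exact_mod_cast le_top))
    push_cast
    refine (contDiff_succ_iff_hasFDerivAt).2 ⟨_, ?_, h⟩
    exact ih (G := fun q => (fderiv ℝ G q).comp (ContinuousLinearMap.inl ℝ E ℝ))
      ((hG.fderiv_right (m := (⊤ : ℕ∞)) (by simp)).clm_comp contDiff_const)

theorem contDiff_intervalIntegral {E F : Type} [NormedAddCommGroup E]
    [NormedSpace ℝ E] [FiniteDimensional ℝ E] [NormedAddCommGroup F] [NormedSpace ℝ F]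
    [CompleteSpace F] {G : E × ℝ → F} (hG : ContDiff ℝ (⊤ : ℕ∞) G) :
    ContDiff ℝ (⊤ : ℕ∞) fun p => ∫ t in (0 : ℝ)..1, G (p, t) :=
  contDiff_infty.2 fun n => contDiff_intervalIntegral_nat n hG

/-- Primitive in the first variable of a smooth function of two variables. -/
theorem contDiff_primitive {f : (Fin 2 → ℝ) → ℝ} (hf : ContDiff ℝ (⊤ : ℕ∞) f) (c : ℝ) :
    ContDiff ℝ (⊤ : ℕ∞) fun p : Fin 2 → ℝ => ∫ s in c..p 0, f ![s, p 1] := by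
  have key : (fun p : Fin 2 → ℝ => ∫ s in c..p 0, f ![s, p 1]) =
      fun p => ∫ t in (0 : ℝ)..1, (p 0 - c) * f ![c + (p 0 - c) * t, p 1] := by
    funext p
    rw [intervalIntegral.integral_const_mul]
    have := intervalIntegral.smul_integral_comp_add_mul (a := 0) (b := 1)
      (fun s => f ![s, p 1]) (p 0 - c) c
    simp only [smul_eq_mul] at this
    rw [this]
    simp
  rw [key]
  refine contDiff_intervalIntegral
    (G := fun q : (Fin 2 → ℝ) × ℝ => (q.1 0 - c) * f ![c + (q.1 0 - c) * q.2, q.1 1]) ?_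
  refine ContDiff.mul (by fun_prop) (hf.comp (contDiff_pi.2 fun i => ?_))
  fin_cases i <;> simp <;> fun_prop

/-- The real numbers with the discrete topology. -/
structure DiscreteReal where
  /-- The underlying real number. -/
  val : ℝ

instance : TopologicalSpace DiscreteReal := ⊥

instance : DiscreteTopology DiscreteReal := ⟨rfl⟩

/-- The covering space of local primitives of a closed `1`-form, given primitives `f i` on open sets
`V i` which pairwise differ by constants. -/
def primitiveCore {B : Type*} [TopologicalSpace B] (V : B → Set B) (hVo : ∀ i, IsOpen (V i))
    (hV : ∀ i, i ∈ V i) (f : B → B → ℝ)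
    (hf : ∀ i j, ∀ x ∈ V i ∩ V j, ∀ y ∈ V i ∩ V j, f j x - f i x = f j y - f i y) :
    FiberBundleCore B B DiscreteReal where
  baseSet := V
  isOpen_baseSet := hVo
  indexAt := id
  mem_baseSet_at := hV
  coordChange i j x v := ⟨v.val + (f j x - f i x)⟩
  coordChange_self := by simp
  continuousOn_coordChange i j := by
    rintro ⟨x, v⟩ ⟨hx, -⟩
    refine ContinuousAt.continuousWithinAt ?_
    refine (continuousAt_const (y := (⟨v.val + (f j x - f i x)⟩ : DiscreteReal))).congr ?_
    have hW : (V i ∩ V j) ×ˢ ({v} : Set DiscreteReal) ∈ 𝓝 (x, v) :=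
      prod_mem_nhds (((hVo i).inter (hVo j)).mem_nhds hx) (by simp)
    filter_upwards [hW]
    rintro ⟨y, w⟩ ⟨hy, rfl⟩
    simp [hf i j x hx y hy]
  coordChange_comp i j k x _ v := by
    congr 1
    ring

/-- A closed `1`-form on a simply connected open set is exact. -/
theorem exists_hasFDerivAt_of_isSimplyConnected {E : Type*} [NormedAddCommGroup E]
    [NormedSpace ℝ E] {U : Set E} (hU : IsOpen U) [SimplyConnectedSpace U] {ω : E → E →L[ℝ] ℝ}
    (hω : DifferentiableOn ℝ ω U)
    (hsymm : ∀ p ∈ U, ∀ v w, fderiv ℝ ω p v w = fderiv ℝ ω p w v) :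
    ∃ f : E → ℝ, ∀ p ∈ U, HasFDerivAt f (ω p) p := by
  classical
  have hloc : ∀ i : U, ∃ ε > 0, Metric.ball (i : E) ε ⊆ U ∧
      ∃ f : E → ℝ, ∀ p ∈ Metric.ball (i : E) ε, HasFDerivAt f (ω p) p := fun i => by
    obtain ⟨ε, hε, hb⟩ := Metric.isOpen_iff.1 hU i i.2
    exact ⟨ε, hε, hb, (convex_ball _ _).exists_forall_hasFDerivAt_of_fderiv_symmetric
      Metric.isOpen_ball (hω.mono hb) fun a ha => hsymm a (hb ha)⟩
  choose ε hε hb f hf using hloc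
  let V : U → Set U := fun i => Subtype.val ⁻¹' Metric.ball (i : E) (ε i)
  have hVo : ∀ i, IsOpen (V i) := fun i => Metric.isOpen_ball.preimage continuous_subtype_val
  let Z := primitiveCore V hVo (fun i => by simp [V, hε]) (fun i x => f i x) (by
    intro i j x hx y hy
    have ho : IsOpen (Metric.ball (i : E) (ε i) ∩ Metric.ball (j : E) (ε j)) :=
      Metric.isOpen_ball.inter Metric.isOpen_ball
    have hd : ∀ p ∈ Metric.ball (i : E) (ε i) ∩ Metric.ball (j : E) (ε j),
        HasFDerivAt (fun p => f j p - f i p) (0 : E →L[ℝ] ℝ) p := fun p hp => by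
      have h := (hf j p hp.2).sub (hf i p hp.1)
      rwa [sub_self] at h
    exact ((convex_ball _ _).inter (convex_ball _ _)).is_const_of_fderivWithin_eq_zero (𝕜 := ℝ)
      (fun p hp => (hd p hp).differentiableAt.differentiableWithinAt)
      (fun p hp => (hd p hp).hasFDerivWithinAt.fderivWithin (ho.uniqueDiffOn p hp)) hx hy)
  have := hU.locallyPathConnectedSpace
  obtain ⟨x₀⟩ : Nonempty U := inferInstance
  have hcov : IsCoveringMap (Bundle.TotalSpace.proj : Z.TotalSpace → U) :=
    FiberBundle.isCoveringMap (F := DiscreteReal) (E := Z.Fiber)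
  obtain ⟨s, ⟨-, hs⟩, -⟩ := hcov.existsUnique_continuousMap_lifts (ContinuousMap.id U) x₀
    ⟨x₀, (⟨0⟩ : DiscreteReal)⟩ rfl
  have hs' : ∀ x, (s x).proj = x := fun x => congrFun hs x
  let v : U → ℝ := fun x => DiscreteReal.val (s x).snd
  refine ⟨fun p => if h : p ∈ U then f ⟨p, h⟩ p - v ⟨p, h⟩ else 0, fun p hp => ?_⟩
  let i : U := ⟨p, hp⟩
  have hi : (s i) ∈ (Z.localTriv i).source := by
    rw [Z.mem_localTriv_source, hs' i]
    exact Z.mem_baseSet_at i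
  have hcont : ContinuousAt (fun x => (Z.localTriv i (s x)).2) i :=
    continuousAt_snd.comp (((Z.localTriv i).continuousAt hi).comp s.continuous.continuousAt)
  have hval : ∀ x, (Z.localTriv i (s x)).2 = ⟨v x + (f i x - f x x)⟩ := fun x => by
    rw [Z.localTriv_apply]
    simp only [hs' x]
    rfl
  have hconst : ∀ᶠ x in 𝓝 i, v x + (f i x - f x x) = v i := by
    filter_upwards [hcont.preimage_mem_nhds
      ((isOpen_discrete _).mem_nhds (mem_singleton (Z.localTriv i (s i)).2))] with x hx
    replace hx : (Z.localTriv i (s x)).2 = (Z.localTriv i (s i)).2 := hx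
    rw [hval, hval] at hx
    simpa using congrArg DiscreteReal.val hx
  refine (((hf i p (by simp [i, hε])).sub_const (v i))).congr_of_eventuallyEq ?_
  rw [nhds_subtype_eq_comap_nhdsWithin] at hconst
  have h2 := eventually_comap.1 hconst
  rw [hU.nhdsWithin_eq hp] at h2
  filter_upwards [h2, hU.mem_nhds hp] with q hq hqU
  have := hq ⟨q, hqU⟩ rfl
  simp only [dif_pos hqU]
  linarith

/-- The coordinate derivative `∂/∂y` on `ℝ²`. -/
noncomputable def partialY (f : (Fin 2 → ℝ) → ℝ) : (Fin 2 → ℝ) → ℝ :=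
  fun p => fderiv ℝ f p ![0, 1]

theorem opX_eq_of_hasDerivAt {f : (Fin 2 → ℝ) → ℝ} {p : Fin 2 → ℝ} {D : ℝ}
    (hf : DifferentiableAt ℝ f p) (h : HasDerivAt (fun t => f ![t, p 1]) D (p 0)) :
    opX f p = D := by
  have hp : ![p 0, p 1] = p := by ext i; fin_cases i <;> rfl
  have hline : HasDerivAt (fun t : ℝ => ![t, p 1]) ![1, 0] (p 0) := by
    rw [hasDerivAt_pi]
    intro i
    fin_cases i
    · exact hasDerivAt_id _
    · exact hasDerivAt_const _ _
  exact (HasFDerivAt.comp_hasDerivAt (p 0)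
    (by rw [hp]; exact hf.hasFDerivAt : HasFDerivAt f (fderiv ℝ f p) ![p 0, p 1]) hline).unique h

theorem partialY_eq_of_hasDerivAt {f : (Fin 2 → ℝ) → ℝ} {p : Fin 2 → ℝ} {D : ℝ}
    (hf : DifferentiableAt ℝ f p) (h : HasDerivAt (fun t => f ![p 0, t]) D (p 1)) :
    partialY f p = D := by
  have hp : ![p 0, p 1] = p := by ext i; fin_cases i <;> rfl
  have hline : HasDerivAt (fun t : ℝ => ![p 0, t]) ![0, 1] (p 1) := by
    rw [hasDerivAt_pi]
    intro i
    fin_cases i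
    · exact hasDerivAt_const _ _
    · exact hasDerivAt_id _
  exact (HasFDerivAt.comp_hasDerivAt (p 1)
    (by rw [hp]; exact hf.hasFDerivAt : HasFDerivAt f (fderiv ℝ f p) ![p 0, p 1]) hline).unique h

theorem mem_ball_fin_two {p z : Fin 2 → ℝ} {r : ℝ} (hr : 0 < r) :
    p ∈ Metric.ball z r ↔ p 0 ∈ Ioo (z 0 - r) (z 0 + r) ∧ p 1 ∈ Ioo (z 1 - r) (z 1 + r) := by
  rw [Metric.mem_ball, dist_pi_lt_iff hr, Fin.forall_fin_two, ← Real.ball_eq_Ioo,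
    ← Real.ball_eq_Ioo, Metric.mem_ball, Metric.mem_ball]

theorem mem_closedBall_fin_two {p z : Fin 2 → ℝ} {r : ℝ} (hr : 0 < r) :
    p ∈ Metric.closedBall z r ↔
      p 0 ∈ Icc (z 0 - r) (z 0 + r) ∧ p 1 ∈ Icc (z 1 - r) (z 1 + r) := by
  rw [Metric.mem_closedBall, dist_pi_le_iff hr.le, Fin.forall_fin_two, ← Real.closedBall_eq_Icc,
    ← Real.closedBall_eq_Icc, Metric.mem_closedBall, Metric.mem_closedBall]

theorem intervalIntegral_eq_zero_of_support_subset_Ioo {g : ℝ → ℝ} {a b t : ℝ}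
    (hg : Function.support g ⊆ Ioo a b) (ht : t ≤ a) : ∫ s in a..t, g s = 0 := by
  rw [intervalIntegral.integral_congr (g := fun _ => 0), intervalIntegral.integral_zero]
  intro s hs
  rw [uIcc_of_ge ht] at hs
  by_contra h
  exact absurd (hg h).1 (not_lt.2 hs.2)

theorem intervalIntegral_eq_integral_of_support_subset_Ioo {g : ℝ → ℝ} {a b t : ℝ}
    (hg : Function.support g ⊆ Ioo a b) (ht : b ≤ t) : ∫ s in a..t, g s = ∫ s, g s :=
  intervalIntegral.integral_eq_integral_of_support_subset fun _ hs =>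
    ⟨(hg hs).1, (hg hs).2.le.trans ht⟩

theorem integral_fin_two_eq {f : (Fin 2 → ℝ) → ℝ} (hf : Integrable f) :
    ∫ p, f p = ∫ y, ∫ x, f ![x, y] := by
  have e := (volume_preserving_finTwoArrow ℝ).symm
  rw [← e.integral_comp (MeasurableEquiv.measurableEmbedding _)]
  have hi := (e.integrable_comp_emb (MeasurableEquiv.measurableEmbedding _)).2 hf
  exact integral_prod_symm _ hi

/-- `f` is the divergence of a smooth vector field on `ℝ²` which vanishes off `K`. -/
def IsDivergenceIn (K : Set (Fin 2 → ℝ)) (f : (Fin 2 → ℝ) → ℝ) : Prop :=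
  ∃ u a : (Fin 2 → ℝ) → ℝ, ContDiff ℝ (⊤ : ℕ∞) u ∧ ContDiff ℝ (⊤ : ℕ∞) a ∧
    Function.support u ⊆ K ∧ Function.support a ⊆ K ∧ ∀ p, opX u p + partialY a p = f p

theorem isDivergenceIn_closedBall {f : (Fin 2 → ℝ) → ℝ} {z : Fin 2 → ℝ} {r : ℝ} (hr : 0 < r)
    (hf : ContDiff ℝ (⊤ : ℕ∞) f) (hsupp : Function.support f ⊆ Metric.ball z r)
    (hint : ∫ p, f p = 0) : IsDivergenceIn (Metric.closedBall z r) f := by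
  let ρ : ContDiffBump (z 0) := ⟨r / 2, r, by positivity, by linarith⟩
  let w : ℝ → ℝ := ρ.normed volume
  have hw : ContDiff ℝ (⊤ : ℕ∞) w := ρ.contDiff_normed
  have hws : Function.support w ⊆ Ioo (z 0 - r) (z 0 + r) := by
    rw [← Real.ball_eq_Ioo]
    exact ρ.support_normed_eq.subset
  have hwi : ∫ s, w s = 1 := ρ.integral_normed
  have hx : ∀ y, Function.support (fun s => f ![s, y]) ⊆ Ioo (z 0 - r) (z 0 + r) := fun y s hs =>
    ((mem_ball_fin_two hr).1 (hsupp hs)).1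
  have hy : ∀ x y, y ∉ Ioo (z 1 - r) (z 1 + r) → f ![x, y] = 0 := fun x y hy => by
    by_contra h
    exact hy ((mem_ball_fin_two hr).1 (hsupp h)).2
  let h : ℝ → ℝ := fun y => ∫ s, f ![s, y]
  have hhs : Function.support h ⊆ Ioo (z 1 - r) (z 1 + r) := fun y hy' => by
    by_contra hn
    exact hy' (by simp [h, hy _ y hn])
  have hh : ContDiff ℝ (⊤ : ℕ∞) h := by
    have h1 : h = (fun p : Fin 2 → ℝ => ∫ s in (z 0 - r)..p 0, f ![s, p 1]) ∘
        fun y => ![z 0 + r, y] := by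
      funext y
      exact (intervalIntegral_eq_integral_of_support_subset_Ioo (hx y) le_rfl).symm
    rw [h1]
    refine (contDiff_primitive hf _).comp (contDiff_pi.2 fun i => ?_)
    fin_cases i
    · exact contDiff_const
    · exact contDiff_id
  have hfi : Integrable f := hf.continuous.integrable_of_hasCompactSupport
    (HasCompactSupport.of_support_subset_isCompact (isCompact_closedBall z r)
      (hsupp.trans Metric.ball_subset_closedBall))
  have hhi : ∫ y, h y = 0 := by rw [← hint, integral_fin_two_eq hfi]
  have hprim : ∀ {g : ℝ → ℝ}, ContDiff ℝ (⊤ : ℕ∞) g → ∀ (c : ℝ) (i : Fin 2),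
      ContDiff ℝ (⊤ : ℕ∞) fun p : Fin 2 → ℝ => ∫ s in c..p i, g s := fun {g} hg c i => by
    have h1 := contDiff_primitive (f := fun q => g (q 0)) (hg.comp (contDiff_apply ℝ ℝ 0)) c
    refine (h1.comp (contDiff_pi.2 fun _ => contDiff_apply ℝ ℝ i :
      ContDiff ℝ (⊤ : ℕ∞) fun p : Fin 2 → ℝ => fun _ : Fin 2 => p i))
  let u : (Fin 2 → ℝ) → ℝ := fun p =>
    (∫ s in (z 0 - r)..p 0, f ![s, p 1]) - (∫ s in (z 0 - r)..p 0, w s) * h (p 1)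
  let a : (Fin 2 → ℝ) → ℝ := fun p => w (p 0) * ∫ s in (z 1 - r)..p 1, h s
  have hu : ContDiff ℝ (⊤ : ℕ∞) u :=
    (contDiff_primitive hf _).sub ((hprim hw _ 0).mul (hh.comp (contDiff_apply ℝ ℝ 1)))
  have ha : ContDiff ℝ (⊤ : ℕ∞) a := (hw.comp (contDiff_apply ℝ ℝ 0)).mul (hprim hh _ 1)
  refine ⟨u, a, hu, ha, fun p hp => ?_, fun p hp => ?_, fun p => ?_⟩
  · rw [mem_closedBall_fin_two hr]
    by_contra hn
    apply hp
    rw [not_and_or] at hn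
    rcases hn with hn | hn
    · rw [mem_Icc, not_and_or, not_le, not_le] at hn
      simp only [u]
      rcases hn with hn | hn
      · rw [intervalIntegral_eq_zero_of_support_subset_Ioo (hx _) hn.le,
          intervalIntegral_eq_zero_of_support_subset_Ioo hws hn.le]
        simp
      · rw [intervalIntegral_eq_integral_of_support_subset_Ioo (hx _) hn.le,
          intervalIntegral_eq_integral_of_support_subset_Ioo hws hn.le, hwi]
        simp [h]
    · have hn' : p 1 ∉ Ioo (z 1 - r) (z 1 + r) := fun h => hn (Ioo_subset_Icc_self h)
      simp [u, h, hy _ _ hn']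
  · rw [mem_closedBall_fin_two hr]
    by_contra hn
    apply hp
    rw [not_and_or] at hn
    rcases hn with hn | hn
    · have : w (p 0) = 0 := by
        by_contra hw0
        exact hn (Ioo_subset_Icc_self (hws hw0))
      simp [a, this]
    · rw [mem_Icc, not_and_or, not_le, not_le] at hn
      simp only [a]
      rcases hn with hn | hn
      · rw [intervalIntegral_eq_zero_of_support_subset_Ioo hhs hn.le, mul_zero]
      · rw [intervalIntegral_eq_integral_of_support_subset_Ioo hhs hn.le, hhi, mul_zero]
  · have hfc : Continuous fun s => f ![s, p 1] := hf.continuous.comp (by fun_prop)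
    have h1 : opX u p = f p - w (p 0) * h (p 1) := by
      refine opX_eq_of_hasDerivAt (hu.differentiable (by simp) p) ?_
      have e1 := (hfc.integral_hasStrictDerivAt (z 0 - r) (p 0)).hasDerivAt
      have e2 := (hw.continuous.integral_hasStrictDerivAt (z 0 - r) (p 0)).hasDerivAt
      have hp : ![p 0, p 1] = p := by ext i; fin_cases i <;> rfl
      rw [hp] at e1
      exact e1.sub (e2.mul_const (h (p 1)))
    have h2 : partialY a p = w (p 0) * h (p 1) := by
      refine partialY_eq_of_hasDerivAt (ha.differentiable (by simp) p) ?_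
      exact (hh.continuous.integral_hasStrictDerivAt (z 1 - r) (p 1)).hasDerivAt.const_mul
        (w (p 0))
    rw [h1, h2]
    ring

theorem IsDivergenceIn.mono {K L : Set (Fin 2 → ℝ)} {f : (Fin 2 → ℝ) → ℝ}
    (h : IsDivergenceIn K f) (hKL : K ⊆ L) : IsDivergenceIn L f := by
  obtain ⟨u, a, hu, ha, hus, has, huv⟩ := h
  exact ⟨u, a, hu, ha, hus.trans hKL, has.trans hKL, huv⟩

theorem IsDivergenceIn.add {K : Set (Fin 2 → ℝ)} {f g : (Fin 2 → ℝ) → ℝ}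
    (hf : IsDivergenceIn K f) (hg : IsDivergenceIn K g) :
    IsDivergenceIn K fun p => f p + g p := by
  obtain ⟨u, a, hu, ha, hus, has, huv⟩ := hf
  obtain ⟨u', a', hu', ha', hus', has', huv'⟩ := hg
  refine ⟨u + u', a + a', hu.add hu', ha.add ha',
    (Function.support_add u u').trans (union_subset hus hus'),
    (Function.support_add a a').trans (union_subset has has'), fun p => ?_⟩
  beta_reduce
  rw [← huv, ← huv', opX, partialY,
    fderiv_add (hu.differentiable (by simp) p) (hu'.differentiable (by simp) p),
    fderiv_add (ha.differentiable (by simp) p) (ha'.differentiable (by simp) p)]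
  simp only [opX, partialY, _root_.add_apply]
  ring

theorem IsDivergenceIn.const_mul {K : Set (Fin 2 → ℝ)} {f : (Fin 2 → ℝ) → ℝ}
    (hf : IsDivergenceIn K f) (m : ℝ) : IsDivergenceIn K fun p => m * f p := by
  obtain ⟨u, a, hu, ha, hus, has, huv⟩ := hf
  refine ⟨m • u, m • a, hu.const_smul m, ha.const_smul m,
    (Function.support_const_smul_subset m u).trans hus,
    (Function.support_const_smul_subset m a).trans has, fun p => ?_⟩
  beta_reduce
  rw [← huv, opX, partialY, fderiv_const_smul (hu.differentiable (by simp) p),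
    fderiv_const_smul (ha.differentiable (by simp) p)]
  simp only [opX, partialY, _root_.smul_apply, smul_eq_mul]
  ring

/-- The family of sets `K` is locally finite at every point of `U`. -/
def LocallyFiniteOn {κ X : Type*} [TopologicalSpace X] (U : Set X) (K : κ → Set X) : Prop :=
  ∀ p ∈ U, ∃ S : Finset κ, ∀ᶠ q in 𝓝 p, ∀ k ∉ S, q ∉ K k

theorem LocallyFiniteOn.eventually_finsum_eq {κ X : Type*} [TopologicalSpace X] {U : Set X}
    {K : κ → Set X} (hK : LocallyFiniteOn U K) {p : X} (hp : p ∈ U) :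
    ∃ S : Finset κ, ∀ w : κ → X → ℝ, (∀ k, Function.support (w k) ⊆ K k) →
      (fun q => ∑ᶠ k, w k q) =ᶠ[𝓝 p] fun q => ∑ k ∈ S, w k q := by
  obtain ⟨S, hS⟩ := hK p hp
  refine ⟨S, fun w hw => ?_⟩
  filter_upwards [hS] with q hq
  refine finsum_eq_sum_of_support_subset _ fun k hk => ?_
  by_contra hkS
  exact hq k hkS (hw k hk)

theorem LocallyFiniteOn.contDiffOn_finsum {κ E : Type*} [NormedAddCommGroup E] [NormedSpace ℝ E]
    {U : Set E} {K : κ → Set E} (hK : LocallyFiniteOn U K) {w : κ → E → ℝ}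
    (hw : ∀ k, Function.support (w k) ⊆ K k) (hwc : ∀ k, ContDiff ℝ (⊤ : ℕ∞) (w k)) :
    ContDiffOn ℝ (⊤ : ℕ∞) (fun q => ∑ᶠ k, w k q) U := fun p hp => by
  obtain ⟨S, hS⟩ := hK.eventually_finsum_eq hp
  exact ((ContDiff.sum fun k _ => hwc k).contDiffAt.congr_of_eventuallyEq
    (hS w hw)).contDiffWithinAt

/-- `f` is the divergence of a smooth vector field on `U`. -/
def IsDivergenceOn (U : Set (Fin 2 → ℝ)) (f : (Fin 2 → ℝ) → ℝ) : Prop :=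
  ∃ u a : (Fin 2 → ℝ) → ℝ, ContDiffOn ℝ (⊤ : ℕ∞) u U ∧ ContDiffOn ℝ (⊤ : ℕ∞) a U ∧
    ∀ p ∈ U, opX u p + partialY a p = f p

theorem LocallyFiniteOn.isDivergenceOn_finsum {κ : Type*} {U : Set (Fin 2 → ℝ)}
    {K : κ → Set (Fin 2 → ℝ)} (hK : LocallyFiniteOn U K) {f : κ → (Fin 2 → ℝ) → ℝ}
    (hf : ∀ k, IsDivergenceIn (K k) (f k)) (hfs : ∀ k, Function.support (f k) ⊆ K k) :
    IsDivergenceOn U fun p => ∑ᶠ k, f k p := by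
  choose u a hu ha hus has huv using hf
  refine ⟨_, _, hK.contDiffOn_finsum hus hu, hK.contDiffOn_finsum has ha, fun p hp => ?_⟩
  obtain ⟨S, hS⟩ := hK.eventually_finsum_eq hp
  beta_reduce
  rw [(hS f hfs).eq_of_nhds, opX, partialY, (hS u hus).fderiv_eq, (hS a has).fderiv_eq,
    fderiv_fun_sum fun k _ => (hu k).differentiable (by simp) p,
    fderiv_fun_sum fun k _ => (ha k).differentiable (by simp) p, _root_.sum_apply,
    _root_.sum_apply, ← Finset.sum_add_distrib]
  exact Finset.sum_congr rfl fun k _ => huv k p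

theorem IsDivergenceOn.add {U : Set (Fin 2 → ℝ)} (hU : IsOpen U) {f g : (Fin 2 → ℝ) → ℝ}
    (hf : IsDivergenceOn U f) (hg : IsDivergenceOn U g) :
    IsDivergenceOn U fun p => f p + g p := by
  obtain ⟨u, a, hu, ha, huv⟩ := hf
  obtain ⟨u', a', hu', ha', huv'⟩ := hg
  refine ⟨u + u', a + a', hu.add hu', ha.add ha', fun p hp => ?_⟩
  have hd : ∀ {w : (Fin 2 → ℝ) → ℝ}, ContDiffOn ℝ (⊤ : ℕ∞) w U → DifferentiableAt ℝ w p :=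
    fun hw => (hw.contDiffAt (hU.mem_nhds hp)).differentiableAt (by simp)
  beta_reduce
  rw [← huv p hp, ← huv' p hp, opX, partialY, fderiv_add (hd hu) (hd hu'),
    fderiv_add (hd ha) (hd ha')]
  simp only [opX, partialY, _root_.add_apply]
  ring

/-- An open set has a cover by open balls whose closures lie in the set and form a locally finite
family. -/
theorem exists_locallyFinite_ball_cover {E : Type} [NormedAddCommGroup E] [NormedSpace ℝ E]
    [FiniteDimensional ℝ E] {U : Set E} (hU : IsOpen U) :
    ∃ (ι : Type) (c : ι → E) (r : ι → ℝ), (∀ i, 0 < r i) ∧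
      (∀ i, Metric.closedBall (c i) (r i) ⊆ U) ∧ U ⊆ ⋃ i, Metric.ball (c i) (r i) ∧
      ∀ K ⊆ U, IsCompact K → {i | (Metric.closedBall (c i) (r i) ∩ K).Nonempty}.Finite := by
  have : ProperSpace E := FiniteDimensional.proper_real E
  have := hU.locallyCompactSpace
  have hbasis : ∀ x : U, (𝓝 x).HasBasis (fun r => 0 < r ∧ Metric.closedBall (x : E) r ⊆ U)
      fun r => Subtype.val ⁻¹' Metric.ball (x : E) r := fun x => by
    rw [nhds_subtype_eq_comap]
    refine HasBasis.comap _ ?_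
    obtain ⟨ε, hε, hb⟩ := Metric.nhds_basis_closedBall.mem_iff.1 (hU.mem_nhds x.2)
    refine Metric.nhds_basis_ball.to_hasBasis (fun r hr => ⟨min r ε, ⟨lt_min hr hε, ?_⟩, ?_⟩)
      fun r hr => ⟨r, hr.1, subset_rfl⟩
    · exact (Metric.closedBall_subset_closedBall (min_le_right _ _)).trans hb
    · exact Metric.ball_subset_ball (min_le_left _ _)
  obtain ⟨ι, c, r, hp, hcov, hfin⟩ := refinement_of_locallyCompact_sigmaCompact_of_nhds_basis hbasis
  refine ⟨ι, fun i => c i, r, fun i => (hp i).1, fun i => (hp i).2, fun x hx => ?_,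
    fun K hKU hK => ?_⟩
  · obtain ⟨i, hi⟩ := mem_iUnion.1 (hcov.symm.subset (mem_univ (⟨x, hx⟩ : U)))
    exact mem_iUnion.2 ⟨i, hi⟩
  · have hK' : IsCompact (Subtype.val ⁻¹' K : Set U) := by
      rw [Subtype.isCompact_iff, Subtype.image_preimage_coe, inter_eq_right.2 hKU]
      exact hK
    refine (hfin.closure.finite_nonempty_inter_compact hK').subset ?_
    rintro i ⟨x, hx, hxK⟩
    refine ⟨⟨x, hKU hxK⟩, ?_, hxK⟩
    rw [← hU.isOpenEmbedding_subtypeVal.isOpenMap.preimage_closure_eq_closure_preimage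
      continuous_subtype_val, closure_ball _ (hp i).1.ne']
    exact hx

/-- On a locally finite graph for which every finitely supported locally constant function vanishes,
every function on the vertices is the divergence of a flow; this is stated in dual form. -/
theorem exists_flow {ι : Type*} (N : ι → ι → Prop) (hNsymm : ∀ i j, N i j → N j i)
    (hN : ∀ i, {j | N i j}.Finite)
    (hinj : ∀ φ : ι →₀ ℝ, (∀ i j, N i j → φ i = φ j) → φ = 0) (m : ι → ℝ) :
    ∃ t : {e : ι × ι // N e.1 e.2} → ℝ, ∀ φ : ι →₀ ℝ,
      ∑ᶠ i, m i * φ i = ∑ᶠ e, t e * (φ e.1.1 - φ e.1.2) := by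
  classical
  have hfin : ∀ φ : ι →₀ ℝ, (Function.support
      fun e : {e : ι × ι // N e.1 e.2} => φ e.1.1 - φ e.1.2).Finite := fun φ => by
    have h1 : (⋃ i ∈ φ.support, {j | N i j}).Finite :=
      φ.support.finite_toSet.biUnion fun i _ => hN i
    have h2 := φ.support.finite_toSet.union h1
    refine ((h2.prod h2).preimage Subtype.val_injective.injOn).subset fun e he => ?_
    by_cases hi : φ e.1.1 = 0
    · have hj : φ e.1.2 ≠ 0 := fun hj => he (by simp [hi, hj])
      exact ⟨Or.inr (mem_biUnion (Finsupp.mem_support_iff.2 hj) (hNsymm _ _ e.2)),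
        Or.inl (Finsupp.mem_support_iff.2 hj)⟩
    · exact ⟨Or.inl (Finsupp.mem_support_iff.2 hi),
        Or.inr (mem_biUnion (Finsupp.mem_support_iff.2 hi) e.2)⟩
  let D : (ι →₀ ℝ) →ₗ[ℝ] ({e : ι × ι // N e.1 e.2} →₀ ℝ) :=
    { toFun := fun φ => Finsupp.ofSupportFinite _ (hfin φ)
      map_add' := fun φ ψ => by
        ext e
        simp only [Finsupp.ofSupportFinite_coe, Finsupp.add_apply]
        ring
      map_smul' := fun s φ => by
        ext e
        simp only [Finsupp.ofSupportFinite_coe, Finsupp.smul_apply, smul_eq_mul, RingHom.id_apply]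
        ring }
  have hD : Function.Injective D := (injective_iff_map_eq_zero D).2 fun φ hφ =>
    hinj φ fun i j hij => sub_eq_zero.1 (DFunLike.congr_fun hφ ⟨(i, j), hij⟩)
  have hsum : ∀ {κ : Type _} (m : κ → ℝ) (φ : κ →₀ ℝ),
      Finsupp.linearCombination ℝ m φ = ∑ᶠ k, m k * φ k := fun m φ => by
    rw [Finsupp.linearCombination_apply, Finsupp.sum, finsum_eq_sum_of_support_subset]
    · exact Finset.sum_congr rfl fun k _ => mul_comm _ _
    · intro k hk
      exact Finsupp.mem_support_iff.2 (right_ne_zero_of_mul hk)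
  obtain ⟨T, hT⟩ := LinearMap.dualMap_surjective_of_injective hD (Finsupp.linearCombination ℝ m)
  refine ⟨fun e => T (Finsupp.single e 1), fun φ => ?_⟩
  have hT' : T = Finsupp.linearCombination ℝ fun e => T (Finsupp.single e 1) := by
    ext e
    simp
  rw [← hsum, ← hT, LinearMap.dualMap_apply, hT', hsum]
  simp [D, Finsupp.ofSupportFinite_coe]

theorem integrable_of_support_subset_ball {f : (Fin 2 → ℝ) → ℝ} {z : Fin 2 → ℝ} {r : ℝ}
    (hf : Continuous f) (hs : Function.support f ⊆ Metric.ball z r) : Integrable f :=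
  hf.integrable_of_hasCompactSupport <|
    HasCompactSupport.intro (isCompact_closedBall z r) fun _ hp =>
      Function.notMem_support.1 fun h => hp (Metric.ball_subset_closedBall (hs h))

theorem exists_contDiff_support_eq_ball_integral_eq_one (z : Fin 2 → ℝ) {r : ℝ} (hr : 0 < r) :
    ∃ g : (Fin 2 → ℝ) → ℝ, ContDiff ℝ (⊤ : ℕ∞) g ∧ Function.support g = Metric.ball z r ∧
      (∀ p, 0 ≤ g p) ∧ ∫ p, g p = 1 := by
  let ρ : ContDiffBump z := ⟨r / 2, r, by positivity, by linarith⟩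
  exact ⟨ρ.normed volume, ρ.contDiff_normed, ρ.support_normed_eq, ρ.nonneg_normed,
    ρ.integral_normed⟩

theorem isDivergenceIn_sub_of_integral_eq {f g : (Fin 2 → ℝ) → ℝ} {z : Fin 2 → ℝ} {r : ℝ}
    (hr : 0 < r) (hf : ContDiff ℝ (⊤ : ℕ∞) f) (hg : ContDiff ℝ (⊤ : ℕ∞) g)
    (hfs : Function.support f ⊆ Metric.ball z r) (hgs : Function.support g ⊆ Metric.ball z r)
    (hfg : ∫ p, f p = ∫ p, g p) :
    IsDivergenceIn (Metric.closedBall z r) fun p => f p - g p := by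
  refine isDivergenceIn_closedBall hr (hf.sub hg)
    ((Function.support_sub f g).trans (union_subset hfs hgs)) ?_
  rw [integral_sub (integrable_of_support_subset_ball hf.continuous hfs)
    (integrable_of_support_subset_ball hg.continuous hgs), hfg, sub_self]

theorem isDivergenceIn_union_sub {f g : (Fin 2 → ℝ) → ℝ} {z w : Fin 2 → ℝ} {r s : ℝ}
    (hr : 0 < r) (hs : 0 < s) (hf : ContDiff ℝ (⊤ : ℕ∞) f) (hg : ContDiff ℝ (⊤ : ℕ∞) g)
    (hfs : Function.support f ⊆ Metric.ball z r) (hgs : Function.support g ⊆ Metric.ball w s)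
    (hf1 : ∫ p, f p = 1) (hg1 : ∫ p, g p = 1)
    (hzw : (Metric.ball z r ∩ Metric.ball w s).Nonempty) :
    IsDivergenceIn (Metric.closedBall z r ∪ Metric.closedBall w s) fun p => f p - g p := by
  obtain ⟨q, hq⟩ := hzw
  obtain ⟨ε, hε, hb⟩ := Metric.isOpen_iff.1 (Metric.isOpen_ball.inter Metric.isOpen_ball) q hq
  obtain ⟨h, hh, hhs, -, hh1⟩ := exists_contDiff_support_eq_ball_integral_eq_one q hε
  rw [← hhs] at hb
  have h1 := isDivergenceIn_sub_of_integral_eq hr hf hh hfs (hb.trans inter_subset_left)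
    (hf1.trans hh1.symm)
  have h2 := isDivergenceIn_sub_of_integral_eq hs hh hg (hb.trans inter_subset_right) hgs
    (hh1.trans hg1.symm)
  convert (h1.mono subset_union_left).add (h2.mono subset_union_right) using 2 with p
  ring

theorem LocallyFiniteOn.of_isCompact {κ X : Type*} [TopologicalSpace X] [LocallyCompactSpace X]
    {U : Set X} (hU : IsOpen U) {K : κ → Set X}
    (hK : ∀ L ⊆ U, IsCompact L → {k | (K k ∩ L).Nonempty}.Finite) : LocallyFiniteOn U K :=
  fun p hp => by
    obtain ⟨L, hL, hLU, hLc⟩ := local_compact_nhds (hU.mem_nhds hp)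
    refine ⟨(hK L hLU hLc).toFinset, ?_⟩
    filter_upwards [hL] with q hq k hk hqk
    exact hk ((hK L hLU hLc).mem_toFinset.2 ⟨q, hqk, hq⟩)

/-- On a connected open subset of the plane, every smooth function is the divergence of a smooth
vector field. -/
theorem ContDiffOn.isDivergenceOn {U : Set (Fin 2 → ℝ)} (hU : IsOpen U) (hUc : IsPreconnected U)
    {r : (Fin 2 → ℝ) → ℝ} (hr : ContDiffOn ℝ (⊤ : ℕ∞) r U) : IsDivergenceOn U r := by
  obtain ⟨ι, c, ε, hε, hεU, hcov, hfin⟩ := exists_locallyFinite_ball_cover hU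
  let B := fun i => Metric.ball (c i) (ε i)
  let K := fun i => Metric.closedBall (c i) (ε i)
  have hBK : ∀ i, B i ⊆ K i := fun i => Metric.ball_subset_closedBall
  have hK : LocallyFiniteOn U K := .of_isCompact hU hfin
  choose g hg hgs hg0 hg1 using fun i =>
    exists_contDiff_support_eq_ball_integral_eq_one (c i) (hε i)
  have hgK : ∀ i, Function.support (g i) ⊆ K i := fun i => (hgs i).subset.trans (hBK i)
  have hgfin : ∀ p ∈ U, (Function.support fun i => g i p).Finite := fun p hp =>
    (hfin {p} (singleton_subset_iff.2 hp) isCompact_singleton).subset fun i hi =>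
      ⟨p, hgK i hi, rfl⟩
  let σ := fun p => ∑ᶠ i, g i p
  have hσ : ContDiffOn ℝ (⊤ : ℕ∞) σ U := hK.contDiffOn_finsum hgK hg
  have hσ0 : ∀ p ∈ U, σ p ≠ 0 := fun p hp => by
    obtain ⟨i, hi⟩ := mem_iUnion.1 (hcov hp)
    refine (finsum_pos (fun i => hg0 i p) ⟨i, (hg0 i p).lt_of_ne' ?_⟩ (hgfin p hp)).ne'
    exact (hgs i).symm.subset hi
  let f := fun i p => g i p * (r p / σ p)
  have hfs : ∀ i, Function.support (f i) ⊆ B i := fun i p hp =>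
    (hgs i).subset (left_ne_zero_of_mul hp)
  have hf : ∀ i, ContDiff ℝ (⊤ : ℕ∞) (f i) := fun i => contDiff_iff_contDiffAt.2 fun p => by
    by_cases hp : p ∈ U
    · have hpU := hU.mem_nhds hp
      exact (hg i).contDiffAt.mul ((hr.contDiffAt hpU).div (hσ.contDiffAt hpU) (hσ0 p hp))
    · have hpK : (K i)ᶜ ∈ 𝓝 p :=
        Metric.isClosed_closedBall.isOpen_compl.mem_nhds fun h => hp (hεU i h)
      refine (contDiffAt_const (c := (0 : ℝ))).congr_of_eventuallyEq ?_
      filter_upwards [hpK] with q hq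
      exact Function.notMem_support.1 fun h => hq (hBK i (hfs i h))
  have hfsum : ∀ p ∈ U, ∑ᶠ i, f i p = r p := fun p hp => by
    rw [← finsum_mul]
    exact mul_div_cancel₀ _ (hσ0 p hp)
  let m := fun i => ∫ p, f i p
  have hfm : ∀ i, IsDivergenceIn (K i) fun p => f i p - m i * g i p := fun i => by
    refine isDivergenceIn_sub_of_integral_eq (hε i) (hf i) (contDiff_const.mul (hg i)) (hfs i)
      ((Function.support_mul_subset_right _ _).trans (hgs i).subset) ?_
    rw [integral_const_mul, hg1, mul_one]
  let N := fun i j => (B i ∩ B j).Nonempty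
  have hNsymm : ∀ i j, N i j → N j i := fun i j h => by
    simpa only [N, inter_comm] using h
  have hNfin : ∀ i, {j | N i j}.Finite := fun i =>
    (hfin (K i) (hεU i) (isCompact_closedBall _ _)).subset fun j ⟨q, hi, hj⟩ =>
      ⟨q, hBK j hj, hBK i hi⟩
  have hinj : ∀ φ : ι →₀ ℝ, (∀ i j, N i j → φ i = φ j) → φ = 0 := fun φ hφ => by
    by_contra hne
    obtain ⟨i₀, hi₀⟩ := DFunLike.ne_iff.1 hne
    have hUV : U ⊆ ⋃ i ∈ φ.support, B i := by
      refine hUc.subset_left_of_subset_union (v := ⋃ i ∈ {i | φ i = 0}, B i)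
        (isOpen_biUnion fun _ _ => Metric.isOpen_ball)
        (isOpen_biUnion fun _ _ => Metric.isOpen_ball) ?_ (fun p hp => ?_) ?_
      · rw [Set.disjoint_left]
        intro p hp hp'
        obtain ⟨i, hi, hpi⟩ := mem_iUnion₂.1 hp
        obtain ⟨j, hj, hpj⟩ := mem_iUnion₂.1 hp'
        exact Finsupp.mem_support_iff.1 hi ((hφ i j ⟨p, hpi, hpj⟩).trans hj)
      · obtain ⟨i, hi⟩ := mem_iUnion.1 (hcov hp)
        by_cases h : φ i = 0
        · exact Or.inr (mem_biUnion (show i ∈ {i | φ i = 0} from h) hi)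
        · exact Or.inl (mem_biUnion (Finsupp.mem_support_iff.2 h) hi)
      · exact ⟨c i₀, hεU i₀ (Metric.mem_closedBall_self (hε i₀).le),
          mem_biUnion (Finsupp.mem_support_iff.2 hi₀) (Metric.mem_ball_self (hε i₀))⟩
    have hUK : U = ⋃ i ∈ φ.support, K i :=
      (hUV.trans (iUnion₂_mono fun i _ => hBK i)).antisymm (iUnion₂_subset fun i _ => hεU i)
    have hcpt : IsCompact U := by
      rw [hUK]
      exact φ.support.isCompact_biUnion fun i _ => isCompact_closedBall _ _
    have huniv : U = univ := IsClopen.eq_univ ⟨hcpt.isClosed, hU⟩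
      ⟨c i₀, hεU i₀ (Metric.mem_closedBall_self (hε i₀).le)⟩
    exact noncompact_univ (Fin 2 → ℝ) (huniv ▸ hcpt)
  obtain ⟨t, ht⟩ := exists_flow N hNsymm hNfin hinj m
  let K' := fun e : {e : ι × ι // N e.1 e.2} => K e.1.1 ∪ K e.1.2
  have hK' : LocallyFiniteOn U K' := .of_isCompact hU fun L hLU hL => by
    have h1 := hfin L hLU hL
    have h2 := h1.union (h1.biUnion fun i _ => hNfin i)
    refine ((h2.prod h2).preimage Subtype.val_injective.injOn).subset fun e he => ?_
    obtain ⟨q, hq | hq, hqL⟩ := he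
    · exact ⟨Or.inl ⟨q, hq, hqL⟩,
        Or.inr (mem_biUnion (show e.1.1 ∈ {k | (K k ∩ L).Nonempty} from ⟨q, hq, hqL⟩) e.2)⟩
    · exact ⟨Or.inr (mem_biUnion (show e.1.2 ∈ {k | (K k ∩ L).Nonempty} from ⟨q, hq, hqL⟩)
        (hNsymm _ _ e.2)), Or.inl ⟨q, hq, hqL⟩⟩
  have hdiv1 := hK.isDivergenceOn_finsum hfm fun i => (Function.support_sub _ _).trans
    (union_subset ((hfs i).trans (hBK i))
      ((Function.support_mul_subset_right _ _).trans (hgK i)))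
  have hdiv2 := hK'.isDivergenceOn_finsum (f := fun e p => t e * (g e.1.1 p - g e.1.2 p))
    (fun e => (isDivergenceIn_union_sub (hε _) (hε _) (hg _) (hg _) (hgs _).subset (hgs _).subset
      (hg1 _) (hg1 _) e.2).const_mul (t e))
    fun e => (Function.support_mul_subset_right _ _).trans <| (Function.support_sub _ _).trans <|
      union_subset_union (hgK _) (hgK _)
  obtain ⟨u, a, hu, ha, hua⟩ := hdiv1.add hU hdiv2
  refine ⟨u, a, hu, ha, fun p hp => ?_⟩
  have htp := ht (Finsupp.ofSupportFinite _ (hgfin p hp))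
  simp only [Finsupp.ofSupportFinite_coe] at htp
  rw [hua p hp]
  beta_reduce
  rw [← htp, finsum_sub_distrib, sub_add_cancel, hfsum p hp]
  · exact (hgfin p hp).subset (Function.support_mul_subset_left _ _)
  · exact (hgfin p hp).subset (Function.support_mul_subset_right _ _)

section DifferentialAlgebra

variable {R : Type*} [CommRing R] [Algebra ℝ R] {D₀ D₁ : Derivation ℝ R R} {x : R}

theorem grushin_compatibility (hD : ∀ f, D₁ (D₀ f) = D₀ (D₁ f)) (h₀ : D₀ x = 1) (h₁ : D₁ x = 0)
    {a b c d E : R} (hE₀ : D₀ E = 0) (hE₁ : D₁ E = 0)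
    (hc : D₀ (D₀ (D₀ b)) - (D₀ (D₀ (x ^ 2 * D₁ a)) + D₀ (2 * x * D₁ a) + 2 * D₁ a) = c)
    (hd : x ^ 2 * D₁ (x ^ 2 * D₁ a) - (x ^ 2 * D₁ (D₀ b) - 2 * x * D₁ b) = E + d) :
    D₀ (D₀ (D₀ d)) + (D₀ (x ^ 2 * D₁ c) + 2 * x * D₁ c) = 0 ∧
      x ^ 2 * D₁ (x ^ 2 * D₁ c) +
        (x ^ 2 * D₁ (D₀ (D₀ d)) - 2 * x * D₁ (D₀ d) + 2 * D₁ d) = 0 := by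
  obtain rfl := eq_sub_of_add_eq' hd.symm
  subst hc
  have h2 : ∀ D : Derivation ℝ R R, D 2 = 0 := fun D => D.map_natCast 2
  constructor <;>
  · simp only [map_sub, map_add, Derivation.leibniz, pow_succ, pow_zero, one_mul, hD, h₀, h₁,
      hE₀, hE₁, h2, smul_eq_mul, map_zero, Derivation.map_one_eq_zero]
    ring

theorem exists_grushin_potential (hD : ∀ f, D₁ (D₀ f) = D₀ (D₁ f)) (h₀ : D₀ x = 1)
    (h₁ : D₁ x = 0) (hclosed : ∀ f g, D₁ f = D₀ g → ∃ h, D₀ h = f ∧ D₁ h = g)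
    (hdiv : ∀ r, ∃ u a, D₀ u + D₁ a = r) {c d : R}
    (hc : D₀ (D₀ (D₀ d)) + (D₀ (x ^ 2 * D₁ c) + 2 * x * D₁ c) = 0)
    (hd : x ^ 2 * D₁ (x ^ 2 * D₁ c) +
      (x ^ 2 * D₁ (D₀ (D₀ d)) - 2 * x * D₁ (D₀ d) + 2 * D₁ d) = 0) :
    ∃ a b E : R, D₀ E = 0 ∧ D₁ E = 0 ∧
      D₀ (D₀ (D₀ b)) - (D₀ (D₀ (x ^ 2 * D₁ a)) + D₀ (2 * x * D₁ a) + 2 * D₁ a) = c ∧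
      x ^ 2 * D₁ (x ^ 2 * D₁ a) - (x ^ 2 * D₁ (D₀ b) - 2 * x * D₁ b) = E + d := by
  obtain ⟨h, hh, hhD⟩ : ∃ h : R, 2 * h = 1 ∧ ∀ D : Derivation ℝ R R, D h = 0 :=
    ⟨algebraMap ℝ R (1 / 2), by rw [← map_ofNat (algebraMap ℝ R) 2, ← map_mul]; norm_num,
      fun D => D.map_algebraMap _⟩
  have h2 : ∀ D : Derivation ℝ R R, D 2 = 0 := fun D => D.map_natCast 2
  simp only [Derivation.leibniz, pow_succ, pow_zero, one_mul, hD, h₀, h₁,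
    smul_eq_mul] at hc hd
  obtain ⟨E, hE⟩ : ∃ E, E = -h * (x ^ 4 * D₁ c + x ^ 2 * D₀ (D₀ d) - 2 * x * D₀ d + 2 * d) :=
    ⟨_, rfl⟩
  have hE₀ : D₀ E = 0 := by
    rw [hE]
    simp only [map_sub, map_add, map_neg, Derivation.leibniz, pow_succ, pow_zero, one_mul, h₀, h2,
      hhD, smul_eq_mul]
    linear_combination -h * x ^ 2 * hc
  have hE₁ : D₁ E = 0 := by
    rw [hE]
    simp only [map_sub, map_add, map_neg, Derivation.leibniz, pow_succ, pow_zero, one_mul, hD, h₁,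
      h2, hhD, smul_eq_mul]
    linear_combination -h * hd
  obtain ⟨e, he⟩ : ∃ e, e = D₀ d - h * x * D₀ (D₀ d) - h * x ^ 3 * D₁ c := ⟨_, rfl⟩
  have hxe : x * e = E + d := by
    rw [he, hE]
    linear_combination (d - x * D₀ d) * hh
  have he₀ : D₀ e = h * D₀ (D₀ d) + h * x ^ 2 * D₁ c := by
    rw [he]
    simp only [map_sub, Derivation.leibniz, pow_succ, pow_zero, one_mul, h₀, hhD,
      smul_eq_mul]
    linear_combination -h * x * hc - D₀ (D₀ d) * hh
  have he₀₀ : D₀ (D₀ e) = -(x * D₁ c) := by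
    rw [he₀]
    simp only [map_add, Derivation.leibniz, pow_succ, pow_zero, one_mul, h₀, hhD,
      smul_eq_mul]
    linear_combination h * hc - x * D₁ c * hh
  obtain ⟨φ, hφ₀, hφ₁⟩ := hclosed (-(x * c)) (D₀ e) (by
    simp only [map_neg, Derivation.leibniz, h₁, he₀₀, smul_eq_mul]
    ring)
  obtain ⟨ψ, hψ₀, hψ₁⟩ := hclosed φ e hφ₁
  obtain ⟨u, a, hua⟩ := hdiv (-(h * c))
  have ha : D₁ a = -(h * c) - D₀ u := eq_sub_of_add_eq' hua
  refine ⟨a, h * (ψ + x * φ) - x ^ 2 * u, E, hE₀, hE₁, ?_, ?_⟩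
  · simp only [map_sub, map_add, map_neg, Derivation.leibniz, pow_succ, pow_zero, one_mul, h₀, h2,
      hhD, ha, hψ₀, hφ₀, smul_eq_mul, map_zero, Derivation.map_one_eq_zero]
    linear_combination c * hh
  · simp only [map_sub, map_add, map_neg, Derivation.leibniz, pow_succ, pow_zero, one_mul, hD, h₀,
      h₁, hhD, ha, hψ₀, hφ₀, hψ₁, hφ₁, smul_eq_mul, map_zero, Derivation.map_one_eq_zero]
    linear_combination hxe + x * e * hh

end DifferentialAlgebra

section SmoothFunctions

variable {E : Type*} [NormedAddCommGroup E] [NormedSpace ℝ E] {U : Set E}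

/-- The algebra of smooth real functions on the subset `U` of a normed space. -/
def smoothFunctions (U : Set E) : Subalgebra ℝ (U → ℝ) where
  carrier := {f | ∃ F : E → ℝ, ContDiffOn ℝ (⊤ : ℕ∞) F U ∧ ∀ p : U, F p = f p}
  add_mem' := by
    rintro f g ⟨F, hF, hFf⟩ ⟨G, hG, hGg⟩
    exact ⟨fun p => F p + G p, hF.add hG, fun p => congrArg₂ (· + ·) (hFf p) (hGg p)⟩
  mul_mem' := by
    rintro f g ⟨F, hF, hFf⟩ ⟨G, hG, hGg⟩
    exact ⟨fun p => F p * G p, hF.mul hG, fun p => congrArg₂ (· * ·) (hFf p) (hGg p)⟩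
  algebraMap_mem' k := ⟨fun _ => k, contDiffOn_const, fun _ => rfl⟩

/-- The smooth function on `U` given by a function that is smooth on `U`. -/
def ContDiffOn.toSmooth {F : E → ℝ} (hF : ContDiffOn ℝ (⊤ : ℕ∞) F U) : smoothFunctions U :=
  ⟨fun p => F p, F, hF, fun _ => rfl⟩

theorem exists_toSmooth_eq (f : smoothFunctions U) :
    ∃ (F : E → ℝ) (hF : ContDiffOn ℝ (⊤ : ℕ∞) F U), hF.toSmooth = f := by
  obtain ⟨F, hF, hFf⟩ := f.2
  exact ⟨F, hF, Subtype.ext (funext hFf)⟩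

theorem toSmooth_eq_toSmooth_iff {F G : E → ℝ} {hF : ContDiffOn ℝ (⊤ : ℕ∞) F U}
    {hG : ContDiffOn ℝ (⊤ : ℕ∞) G U} :
    hF.toSmooth = hG.toSmooth ↔ EqOn F G U :=
  ⟨fun h p hp => congrFun (congrArg Subtype.val h) ⟨p, hp⟩,
    fun h => Subtype.ext (funext fun p => h p.2)⟩

theorem ContDiffOn.fderiv_apply_of_isOpen (hU : IsOpen U) {F : E → ℝ}
    (hF : ContDiffOn ℝ (⊤ : ℕ∞) F U) (v : E) :
    ContDiffOn ℝ (⊤ : ℕ∞) (fun p => fderiv ℝ F p v) U :=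
  (hF.fderiv_of_isOpen hU (m := (⊤ : ℕ∞)) (by simp)).clm_apply contDiffOn_const

theorem Set.EqOn.fderiv_of_isOpen (hU : IsOpen U) {F G : E → ℝ} (h : EqOn F G U) {p : E}
    (hp : p ∈ U) : fderiv ℝ F p = fderiv ℝ G p :=
  (h.eventuallyEq_of_mem (hU.mem_nhds hp)).fderiv_eq

/-- The derivative of smooth functions on `U` in the direction `v`. -/
noncomputable def directionalDeriv (hU : IsOpen U) (v : E) :
    Derivation ℝ (smoothFunctions U) (smoothFunctions U) :=
  have key : ∀ {F : E → ℝ} (f : smoothFunctions U) (_ : ContDiffOn ℝ (⊤ : ℕ∞) F U),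
      (∀ p : U, F p = f.1 p) → ∀ p : U, fderiv ℝ f.2.choose p v = fderiv ℝ F p v :=
    fun f _ h p => by
      rw [EqOn.fderiv_of_isOpen hU (fun q hq =>
        (f.2.choose_spec.2 ⟨q, hq⟩).trans (h ⟨q, hq⟩).symm) p.2]
  have hd : ∀ (f : smoothFunctions U) (p : U), DifferentiableAt ℝ f.2.choose p := fun f p =>
    (f.2.choose_spec.1.contDiffAt (hU.mem_nhds p.2)).differentiableAt (by simp)
  Derivation.mk'
    { toFun := fun f => (f.2.choose_spec.1.fderiv_apply_of_isOpen hU v).toSmooth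
      map_add' := fun f g => Subtype.ext <| funext fun p => by
        have := key (f + g) (f.2.choose_spec.1.add g.2.choose_spec.1)
          (fun q => congrArg₂ (· + ·) (f.2.choose_spec.2 q) (g.2.choose_spec.2 q)) p
        rw [fderiv_fun_add (hd f p) (hd g p)] at this
        exact this
      map_smul' := fun k f => Subtype.ext <| funext fun p => by
        have := key (k • f) (f.2.choose_spec.1.const_smul k)
          (fun q => congrArg (k • ·) (f.2.choose_spec.2 q)) p
        rw [fderiv_fun_const_smul (hd f p)] at this
        exact this }
    fun f g => Subtype.ext <| funext fun p => by
      have := key (f * g) (f.2.choose_spec.1.mul g.2.choose_spec.1)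
        (fun q => congrArg₂ (· * ·) (f.2.choose_spec.2 q) (g.2.choose_spec.2 q)) p
      rw [fderiv_fun_mul (hd f p) (hd g p), f.2.choose_spec.2 p, g.2.choose_spec.2 p] at this
      exact this

theorem directionalDeriv_toSmooth (hU : IsOpen U) (v : E) {F : E → ℝ}
    (hF : ContDiffOn ℝ (⊤ : ℕ∞) F U) :
    directionalDeriv hU v hF.toSmooth = (hF.fderiv_apply_of_isOpen hU v).toSmooth :=
  Subtype.ext <| funext fun p => by
    have h : EqOn hF.toSmooth.2.choose F U := fun q hq => hF.toSmooth.2.choose_spec.2 ⟨q, hq⟩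
    exact congrArg (· v) (h.fderiv_of_isOpen hU p.2)

theorem directionalDeriv_comm (hU : IsOpen U) (v w : E) (f : smoothFunctions U) :
    directionalDeriv hU v (directionalDeriv hU w f) =
      directionalDeriv hU w (directionalDeriv hU v f) := by
  obtain ⟨F, hF, rfl⟩ := exists_toSmooth_eq f
  simp only [directionalDeriv_toSmooth]
  refine toSmooth_eq_toSmooth_iff.2 fun p hp => ?_
  have hFp := hF.contDiffAt (hU.mem_nhds hp)
  have hd : DifferentiableAt ℝ (fderiv ℝ F) p :=
    (hFp.fderiv_right (m := 1) (by norm_cast)).differentiableAt (by simp)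
  have hdv : ∀ v w, fderiv ℝ (fun q => fderiv ℝ F q w) p v = fderiv ℝ (fderiv ℝ F) p v w :=
    fun v w => by
      rw [fderiv_clm_apply hd (differentiableAt_const w)]
      simp
  rw [hdv, hdv]
  exact hFp.isSymmSndFDerivAt (by simp; norm_cast) v w

end SmoothFunctions

theorem ContinuousLinearMap.apply_fin_two (L : (Fin 2 → ℝ) →L[ℝ] ℝ) (v : Fin 2 → ℝ) :
    L v = v 0 * L ![1, 0] + v 1 * L ![0, 1] := by
  have hv : v = v 0 • ![1, 0] + v 1 • ![0, 1] := by ext i; fin_cases i <;> simp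
  rw [← smul_eq_mul, ← smul_eq_mul, ← map_smul, ← map_smul, ← map_add, ← hv]

section Plane

variable {U : Set (Fin 2 → ℝ)}

theorem exists_directionalDeriv_eq (hU : IsOpen U) [SimplyConnectedSpace U]
    (f g : smoothFunctions U)
    (hfg : directionalDeriv hU ![0, 1] f = directionalDeriv hU ![1, 0] g) :
    ∃ h, directionalDeriv hU ![1, 0] h = f ∧ directionalDeriv hU ![0, 1] h = g := by
  obtain ⟨F, hF, rfl⟩ := exists_toSmooth_eq f
  obtain ⟨G, hG, rfl⟩ := exists_toSmooth_eq g
  rw [directionalDeriv_toSmooth, directionalDeriv_toSmooth, toSmooth_eq_toSmooth_iff] at hfg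
  let π : Fin 2 → (Fin 2 → ℝ) →L[ℝ] ℝ := ContinuousLinearMap.proj
  let ω := fun p => F p • π 0 + G p • π 1
  have hω : ContDiffOn ℝ (⊤ : ℕ∞) ω U :=
    (hF.smul contDiffOn_const).add (hG.smul contDiffOn_const)
  have hω' : ∀ p ∈ U, ∀ v w,
      fderiv ℝ ω p v w = fderiv ℝ F p v * w 0 + fderiv ℝ G p v * w 1 := fun p hp v w => by
    have hFp := (hF.contDiffAt (hU.mem_nhds hp)).differentiableAt (by simp)
    have hGp := (hG.contDiffAt (hU.mem_nhds hp)).differentiableAt (by simp)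
    have := ((hFp.hasFDerivAt.smul_const (π 0)).add (hGp.hasFDerivAt.smul_const (π 1))).fderiv
    change (fderiv ℝ (fun p => F p • π 0 + G p • π 1) p) v w = _
    rw [show (fun p => F p • π 0 + G p • π 1) = (fun p => F p • π 0) + fun p => G p • π 1 from rfl,
      this]
    simp [π]
  obtain ⟨H, hH⟩ := exists_hasFDerivAt_of_isSimplyConnected hU (hω.differentiableOn (by simp))
    fun p hp v w => by
      have h := hfg hp
      beta_reduce at h
      rw [hω' p hp, hω' p hp, (fderiv ℝ F p).apply_fin_two v, (fderiv ℝ F p).apply_fin_two w,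
        (fderiv ℝ G p).apply_fin_two v, (fderiv ℝ G p).apply_fin_two w, h]
      ring
  have hHc : ContDiffOn ℝ (⊤ : ℕ∞) H U := (contDiffOn_infty_iff_fderiv_of_isOpen hU).2
    ⟨fun p hp => (hH p hp).differentiableAt.differentiableWithinAt,
      hω.congr fun p hp => (hH p hp).fderiv⟩
  refine ⟨hHc.toSmooth, ?_, ?_⟩ <;>
  · rw [directionalDeriv_toSmooth, toSmooth_eq_toSmooth_iff]
    intro p hp
    beta_reduce
    rw [(hH p hp).fderiv]
    simp [ω, π]

theorem exists_directionalDeriv_add_eq (hU : IsOpen U) (hUc : IsPreconnected U)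
    (r : smoothFunctions U) :
    ∃ u a, directionalDeriv hU ![1, 0] u + directionalDeriv hU ![0, 1] a = r := by
  obtain ⟨F, hF, rfl⟩ := exists_toSmooth_eq r
  obtain ⟨u, a, hu, ha, hua⟩ := hF.isDivergenceOn hU hUc
  refine ⟨hu.toSmooth, ha.toSmooth, ?_⟩
  rw [directionalDeriv_toSmooth, directionalDeriv_toSmooth]
  exact Subtype.ext (funext fun p => hua p p.2)

theorem exists_eq_const_of_directionalDeriv_eq_zero (hU : IsOpen U) (hUc : IsPreconnected U)
    {f : smoothFunctions U} (h₀ : directionalDeriv hU ![1, 0] f = 0)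
    (h₁ : directionalDeriv hU ![0, 1] f = 0) : ∃ k : ℝ, ∀ p, f.1 p = k := by
  obtain ⟨F, hF, rfl⟩ := exists_toSmooth_eq f
  rw [directionalDeriv_toSmooth] at h₀ h₁
  obtain ⟨k, hk⟩ := hU.exists_is_const_of_fderiv_eq_zero hUc (hF.differentiableOn (by simp))
    fun p hp => ContinuousLinearMap.ext fun v => by
      have h0 : fderiv ℝ F p ![1, 0] = 0 := congrFun (congrArg Subtype.val h₀) ⟨p, hp⟩
      have h1 : fderiv ℝ F p ![0, 1] = 0 := congrFun (congrArg Subtype.val h₁) ⟨p, hp⟩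
      rw [ContinuousLinearMap.apply_fin_two, h0, h1]
      simp
  exact ⟨k, fun p => hk p p.2⟩

/-- The function `F` restricts to the smooth function `f` on `U`. -/
def RestrictsTo (F : (Fin 2 → ℝ) → ℝ) (f : smoothFunctions U) : Prop :=
  ∀ p : U, F p = f.1 p

/-- The first coordinate as a smooth function on `U`. -/
noncomputable def firstCoord (U : Set (Fin 2 → ℝ)) : smoothFunctions U :=
  (contDiff_apply ℝ ℝ (0 : Fin 2)).contDiffOn.toSmooth

theorem directionalDeriv_firstCoord (hU : IsOpen U) (v : Fin 2 → ℝ) :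
    directionalDeriv hU v (firstCoord U) = algebraMap ℝ _ (v 0) := by
  rw [firstCoord, directionalDeriv_toSmooth]
  exact Subtype.ext <| funext fun p =>
    congrArg (· v) (ContinuousLinearMap.proj (R := ℝ) (φ := fun _ : Fin 2 => ℝ) 0).fderiv

variable {F : (Fin 2 → ℝ) → ℝ} {f : smoothFunctions U}

theorem RestrictsTo.fderiv_apply (hU : IsOpen U) (h : RestrictsTo F f) (v : Fin 2 → ℝ) (p : U) :
    fderiv ℝ F p v = (directionalDeriv hU v f).1 p := by
  obtain ⟨G, hG, rfl⟩ := exists_toSmooth_eq f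
  rw [directionalDeriv_toSmooth]
  exact congrArg (· v) (EqOn.fderiv_of_isOpen hU (fun q hq => h ⟨q, hq⟩) p.2)

theorem RestrictsTo.opX (hU : IsOpen U) (h : RestrictsTo F f) :
    RestrictsTo (opX F) (directionalDeriv hU ![1, 0] f) :=
  h.fderiv_apply hU _

theorem RestrictsTo.opY (hU : IsOpen U) (h : RestrictsTo F f) :
    RestrictsTo (opY F) (firstCoord U ^ 2 * directionalDeriv hU ![0, 1] f) := fun p => by
  rw [_root_.opY, ContinuousLinearMap.apply_fin_two, h.fderiv_apply hU ![0, 1]]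
  simp [firstCoord, ContDiffOn.toSmooth]

theorem RestrictsTo.opZ (hU : IsOpen U) (h : RestrictsTo F f) :
    RestrictsTo (opZ F) (2 * firstCoord U * directionalDeriv hU ![0, 1] f) := fun p => by
  rw [_root_.opZ, ContinuousLinearMap.apply_fin_two, h.fderiv_apply hU ![0, 1]]
  simp [firstCoord, ContDiffOn.toSmooth]
  exact Or.inl (Or.inl rfl)

theorem RestrictsTo.opW (hU : IsOpen U) (h : RestrictsTo F f) :
    RestrictsTo (opW F) (2 * directionalDeriv hU ![0, 1] f) := fun p => by
  rw [_root_.opW, ContinuousLinearMap.apply_fin_two, h.fderiv_apply hU ![0, 1]]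
  simp
  exact Or.inl rfl

end Plane

end

theorem second_grushin_degree_two_integrability
    (U : Set (Fin 2 → ℝ)) (hU : IsOpen U) (hUc : ContractibleSpace U)
    (c d : (Fin 2 → ℝ) → ℝ)
    (hc : ContDiffOn ℝ (⊤ : ℕ∞) c U) (hd : ContDiffOn ℝ (⊤ : ℕ∞) d U) :
    (∀ p ∈ U, opX (opX (opX d)) p + (opX (opY c) p + opZ c p) = 0 ∧
              opY (opY c) p +
                (opY (opX (opX d)) p - opZ (opX d) p + opW d p) = 0) ↔
    (∃ a b : (Fin 2 → ℝ) → ℝ, ∃ E : ℝ,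
      ContDiffOn ℝ (⊤ : ℕ∞) a U ∧ ContDiffOn ℝ (⊤ : ℕ∞) b U ∧
      ∀ p ∈ U,
        opX (opX (opX b)) p -
          (opX (opX (opY a)) p + opX (opZ a) p + opW a p) = c p ∧
        opY (opY a) p - (opY (opX b) p - opZ b p) = E + d p) := by
  have hUp : IsPreconnected U := isPreconnected_iff_preconnectedSpace.2 inferInstance
  let D₀ := directionalDeriv hU ![1, 0]
  let D₁ := directionalDeriv hU ![0, 1]
  let x := firstCoord U
  have hD : ∀ f, D₁ (D₀ f) = D₀ (D₁ f) := directionalDeriv_comm hU _ _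
  have h₀ : D₀ x = 1 := (directionalDeriv_firstCoord hU _).trans (map_one _)
  have h₁ : D₁ x = 0 := (directionalDeriv_firstCoord hU _).trans (map_zero _)
  have hcr : RestrictsTo c hc.toSmooth := fun _ => rfl
  have hdr : RestrictsTo d hd.toSmooth := fun _ => rfl
  have hc0 : RestrictsTo (fun p => opX (opX (opX d)) p + (opX (opY c) p + opZ c p))
      (D₀ (D₀ (D₀ hd.toSmooth)) + (D₀ (x ^ 2 * D₁ hc.toSmooth) + 2 * x * D₁ hc.toSmooth)) :=
    fun p => congrArg₂ (· + ·) (((hdr.opX hU).opX hU).opX hU p)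
      (congrArg₂ (· + ·) ((hcr.opY hU).opX hU p) (hcr.opZ hU p))
  have hd0 : RestrictsTo
      (fun p => opY (opY c) p + (opY (opX (opX d)) p - opZ (opX d) p + opW d p))
      (x ^ 2 * D₁ (x ^ 2 * D₁ hc.toSmooth) + (x ^ 2 * D₁ (D₀ (D₀ hd.toSmooth)) -
        2 * x * D₁ (D₀ hd.toSmooth) + 2 * D₁ hd.toSmooth)) :=
    fun p => congrArg₂ (· + ·) ((hcr.opY hU).opY hU p) (congrArg₂ (· + ·)
      (congrArg₂ (· - ·) (((hdr.opX hU).opX hU).opY hU p) ((hdr.opX hU).opZ hU p)) (hdr.opW hU p))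
  have hcab : ∀ {a b : (Fin 2 → ℝ) → ℝ} {f g : smoothFunctions U}, RestrictsTo a f →
      RestrictsTo b g → RestrictsTo
        (fun p => opX (opX (opX b)) p - (opX (opX (opY a)) p + opX (opZ a) p + opW a p))
        (D₀ (D₀ (D₀ g)) - (D₀ (D₀ (x ^ 2 * D₁ f)) + D₀ (2 * x * D₁ f) + 2 * D₁ f)) :=
    fun ha hb p => congrArg₂ (· - ·) (((hb.opX hU).opX hU).opX hU p) (congrArg₂ (· + ·)
      (congrArg₂ (· + ·) (((ha.opY hU).opX hU).opX hU p) ((ha.opZ hU).opX hU p)) (ha.opW hU p))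
  have hdab : ∀ {a b : (Fin 2 → ℝ) → ℝ} {f g : smoothFunctions U}, RestrictsTo a f →
      RestrictsTo b g → RestrictsTo
        (fun p => opY (opY a) p - (opY (opX b) p - opZ b p))
        (x ^ 2 * D₁ (x ^ 2 * D₁ f) - (x ^ 2 * D₁ (D₀ g) - 2 * x * D₁ g)) :=
    fun ha hb p => congrArg₂ (· - ·) ((ha.opY hU).opY hU p)
      (congrArg₂ (· - ·) ((hb.opX hU).opY hU p) (hb.opZ hU p))
  constructor
  · intro h
    obtain ⟨f, g, e, he₀, he₁, hfc, hfd⟩ := exists_grushin_potential hD h₀ h₁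
      (exists_directionalDeriv_eq hU) (exists_directionalDeriv_add_eq hU hUp)
      (Subtype.ext (funext fun p => (hc0 p).symm.trans (h p p.2).1))
      (Subtype.ext (funext fun p => (hd0 p).symm.trans (h p p.2).2))
    obtain ⟨a, ha, rfl⟩ := exists_toSmooth_eq f
    obtain ⟨b, hb, rfl⟩ := exists_toSmooth_eq g
    obtain ⟨E, hE⟩ := exists_eq_const_of_directionalDeriv_eq_zero hU hUp he₀ he₁
    refine ⟨a, b, E, ha, hb, fun p hp => ⟨?_, ?_⟩⟩
    · exact (hcab (fun _ => rfl) (fun _ => rfl) ⟨p, hp⟩).trans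
        (congrFun (congrArg Subtype.val hfc) ⟨p, hp⟩)
    · refine (hdab (fun _ => rfl) (fun _ => rfl) ⟨p, hp⟩).trans
        ((congrFun (congrArg Subtype.val hfd) ⟨p, hp⟩).trans ?_)
      exact congrArg (· + d p) (hE ⟨p, hp⟩)
  · rintro ⟨a, b, E, ha, hb, h⟩ p hp
    have har : RestrictsTo a ha.toSmooth := fun _ => rfl
    have hbr : RestrictsTo b hb.toSmooth := fun _ => rfl
    obtain ⟨h1, h2⟩ := grushin_compatibility hD h₀ h₁ (c := hc.toSmooth) (d := hd.toSmooth)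
      (E := algebraMap ℝ _ E) (D₀.map_algebraMap E) (D₁.map_algebraMap E)
      (Subtype.ext (funext fun p => (hcab har hbr p).symm.trans (h p p.2).1))
      (Subtype.ext (funext fun p => (hdab har hbr p).symm.trans (h p p.2).2))
    exact ⟨(hc0 ⟨p, hp⟩).trans (congrFun (congrArg Subtype.val h1) ⟨p, hp⟩),
      (hd0 ⟨p, hp⟩).trans (congrFun (congrArg Subtype.val h2) ⟨p, hp⟩)⟩
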